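/- arXiv:math/0610135 — 5 statements merged into one kernel-verified Lean document; each statement's English description precedes it below -/
import Mathlib

section
/- Let R be a ring and M a self-injective left R-module. If M is distributive as a left R-module, then the endomorphism ring End_R(M) is right distributive. -/
/-!
STATEMENT 1. Endomorphisms of a left module are written on the right in the paper, so the
paper's endomorphism ring `S` is the opposite of Lean's `Module.End R M`; hence "the
endomorphism ring is right distributive" means that the lattice `Ideal (Module.End R M)`
(ideals for composition on the left) is distributive.
-/

universe u v

/-- A left `R`-module `M` is self-injective if every `R`-linear map from a submodule of `M`
into `M` extends to an endomorphism of `M`. -/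
def IsSelfInjective (R : Type u) (M : Type v) [Ring R] [AddCommGroup M] [Module R M] : Prop :=
  ∀ (N : Submodule R M) (f : N →ₗ[R] M), ∃ g : Module.End R M, ∀ x : N, g x = f x

namespace IsSelfInjective

variable {R : Type u} {M : Type v} [Ring R] [AddCommGroup M] [Module R M]

/-- Over a self-injective module, an endomorphism whose kernel contains that of `b` is a left
multiple of `b`. -/
theorem exists_mul_eq_of_ker_le (hM : IsSelfInjective R M) {b u : Module.End R M}
    (h : LinearMap.ker b ≤ LinearMap.ker u) : ∃ g : Module.End R M, g * b = u := by
  obtain ⟨g, hg⟩ := hM (LinearMap.range b)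
    ((LinearMap.ker b).liftQ u h ∘ₗ b.quotKerEquivRange.symm.toLinearMap)
  refine ⟨g, LinearMap.ext fun x => ?_⟩
  have hx : b.quotKerEquivRange ((LinearMap.ker b).mkQ x) = ⟨b x, LinearMap.mem_range_self b x⟩ :=
    rfl
  simpa [← hx] using hg ⟨b x, LinearMap.mem_range_self b x⟩

/-- Over a self-injective module, for disjoint submodules `P` and `Q` there is an endomorphism
vanishing on `P` and restricting to the identity on `Q`. -/
theorem exists_eq_zero_eq_self (hM : IsSelfInjective R M) {P Q : Submodule R M}
    (h : Disjoint P Q) :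
    ∃ g : Module.End R M, (∀ x ∈ P, g x = 0) ∧ ∀ y ∈ Q, g y = y := by
  let f₁ : M →ₗ.[R] M := ⟨P, 0⟩
  let f₂ : M →ₗ.[R] M := ⟨Q, Q.subtype⟩
  have hf : ∀ (x : f₁.domain) (y : f₂.domain), (x : M) = y → f₁ x = f₂ y := by
    rintro ⟨x, hx⟩ ⟨y, hy⟩ rfl
    exact (Submodule.disjoint_def.1 h x hx hy).symm
  obtain ⟨g, hg⟩ := hM _ (f₁.sup f₂ hf).toFun
  refine ⟨g, fun x hx => ?_, fun y hy => ?_⟩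
  · exact (hg ⟨x, Submodule.mem_sup_left hx⟩).trans
      ((f₁.left_le_sup f₂ hf).2 (x := ⟨x, hx⟩) rfl).symm
  · exact (hg ⟨y, Submodule.mem_sup_right hy⟩).trans
      ((f₁.right_le_sup f₂ hf).2 (x := ⟨y, hy⟩) rfl).symm

end IsSelfInjective

/-- In a distributive module, the images under `b + c` of the kernels of `b` and `c` are
disjoint. -/
theorem disjoint_map_ker_add {R : Type u} {M : Type v} [Ring R] [AddCommGroup M] [Module R M]
    (hdist : ∀ N L K : Submodule R M, N ⊓ (L ⊔ K) = (N ⊓ L) ⊔ (N ⊓ K))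
    (b c : Module.End R M) :
    Disjoint ((LinearMap.ker b).map (b + c)) ((LinearMap.ker c).map (b + c)) := by
  rw [Submodule.disjoint_def]
  rintro _ ⟨x, hx, rfl⟩ ⟨y, hy, hxy⟩
  have hle : LinearMap.ker b ⊓ (LinearMap.ker (b + c) ⊔ LinearMap.ker c) ≤
      LinearMap.ker (b + c) := by
    rw [hdist]
    refine sup_le inf_le_right fun z hz => ?_
    have hb : b z = 0 := hz.1
    have hc : c z = 0 := hz.2
    simp [hb, hc]
  refine hle ⟨hx, Submodule.mem_sup.2 ⟨x - y, ?_, y, hy, sub_add_cancel x y⟩⟩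
  rw [LinearMap.mem_ker, map_sub, hxy, sub_self]

/-- If a self-injective left `R`-module `M` is distributive (its lattice of submodules is
distributive), then its endomorphism ring is right distributive. -/
theorem end_right_distributive_of_selfInjective_distributive {R : Type u} {M : Type v}
    [Ring R] [AddCommGroup M] [Module R M] (hM : IsSelfInjective R M)
    (hdist : ∀ N L K : Submodule R M, N ⊓ (L ⊔ K) = (N ⊓ L) ⊔ (N ⊓ K)) :
    ∀ I J K : Ideal (Module.End R M), I ⊓ (J ⊔ K) = (I ⊓ J) ⊔ (I ⊓ K) := by
  intro I J K
  refine le_antisymm ?_ le_inf_sup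
  rintro a ⟨haI, haJK⟩
  obtain ⟨b, hb, c, hc, rfl⟩ := Submodule.mem_sup.1 haJK
  obtain ⟨g, hg₀, hg₁⟩ := hM.exists_eq_zero_eq_self (disjoint_map_ker_add hdist b c)
  obtain ⟨s, hs⟩ : ∃ s, s * b = g * (b + c) := hM.exists_mul_eq_of_ker_le fun x hx =>
    hg₀ _ (Submodule.mem_map_of_mem hx)
  obtain ⟨t, ht⟩ : ∃ t, t * c = (1 - g) * (b + c) := hM.exists_mul_eq_of_ker_le fun x hx =>
    sub_eq_zero.2 (hg₁ _ (Submodule.mem_map_of_mem hx)).symm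
  refine Submodule.mem_sup.2 ⟨g * (b + c), ⟨I.mul_mem_left _ haI, ?_⟩,
    (1 - g) * (b + c), ⟨I.mul_mem_left _ haI, ?_⟩, ?_⟩
  · exact hs ▸ J.mul_mem_left s hb
  · exact ht ▸ K.mul_mem_left t hc
  · rw [← add_mul, add_sub_cancel, one_mul]
end

section
/- Let R be a ring and M a self-injective left R-module which is also a self-cogenerator. Then M is a distributive left R-module if and only if End_R(M) is a right distributive ring. -/
/-!
STATEMENT 3. Endomorphisms of a left module are written on the right in the paper, so the
paper's endomorphism ring `S` is the opposite of Lean's `Module.End R M`; hence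
"`End_R(M)` is right distributive" means that `Ideal (Module.End R M)` (ideals for
composition on the left) is a distributive lattice.
-/

universe u v

/-- A left `R`-module `M` is a self-cogenerator if every factor module of `M` embeds into a
direct product of copies of `M`. -/
def IsSelfCogenerator (R : Type u) (M : Type v) [Ring R] [AddCommGroup M] [Module R M] :
    Prop :=
  ∀ N : Submodule R M, ∃ (ι : Type v) (φ : (M ⧸ N) →ₗ[R] (ι → M)), Function.Injective φ

/-- The left ideal of endomorphisms that vanish on the submodule `N`. -/
def Submodule.endAnnihilator {R : Type u} {M : Type v} [Ring R] [AddCommGroup M] [Module R M]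
    (N : Submodule R M) : Ideal (Module.End R M) where
  carrier := {f | ∀ x ∈ N, f x = 0}
  zero_mem' _ _ := rfl
  add_mem' hf hg x hx := by simp [hf x hx, hg x hx]
  smul_mem' c f hf x hx := by simp [hf x hx]

section

variable {R : Type u} {M : Type v} [Ring R] [AddCommGroup M] [Module R M]

theorem Submodule.mem_endAnnihilator {N : Submodule R M} {f : Module.End R M} :
    f ∈ N.endAnnihilator ↔ ∀ x ∈ N, f x = 0 :=
  Iff.rfl

theorem Submodule.endAnnihilator_sup (A B : Submodule R M) :
    (A ⊔ B).endAnnihilator = A.endAnnihilator ⊓ B.endAnnihilator := by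
  ext f
  exact sup_le_iff (c := LinearMap.ker f)

theorem IsSelfInjective.exists_comp_eq (hinj : IsSelfInjective R M) {P : Type*}
    [AddCommGroup P] [Module R P] (f h : P →ₗ[R] M)
    (hfh : LinearMap.ker f ≤ LinearMap.ker h) : ∃ g : Module.End R M, g ∘ₗ f = h := by
  obtain ⟨g, hg⟩ := hinj (LinearMap.range f)
    ((LinearMap.ker f).liftQ h hfh ∘ₗ f.quotKerEquivRange.symm.toLinearMap)
  refine ⟨g, LinearMap.ext fun x ↦ ?_⟩
  have hx := hg (f.quotKerEquivRange (Submodule.Quotient.mk x))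
  simpa using hx

theorem IsSelfInjective.endAnnihilator_ker (hinj : IsSelfInjective R M)
    (f : Module.End R M) : (LinearMap.ker f).endAnnihilator = Ideal.span {f} := by
  ext h
  rw [Ideal.mem_span_singleton']
  refine ⟨fun hh ↦ hinj.exists_comp_eq f h hh, ?_⟩
  rintro ⟨g, rfl⟩ x hx
  simp [LinearMap.mem_ker.mp hx]

theorem IsSelfInjective.endAnnihilator_inf (hinj : IsSelfInjective R M)
    (A B : Submodule R M) :
    (A ⊓ B).endAnnihilator = A.endAnnihilator ⊔ B.endAnnihilator := by
  refine le_antisymm (fun h hh ↦ ?_)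
    (sup_le (fun f hf x hx ↦ hf x hx.1) (fun f hf x hx ↦ hf x hx.2))
  obtain ⟨g, hg⟩ := hinj.exists_comp_eq (A.subtype.coprod B.subtype)
    (h ∘ₗ B.subtype ∘ₗ LinearMap.snd R A B) (by
      rintro ⟨a, b⟩ hab
      have hab' : (a : M) + b = 0 := by simpa using hab
      have hb : (b : M) ∈ A := by
        rw [← neg_eq_of_add_eq_zero_right hab']
        exact A.neg_mem a.2
      exact hh b ⟨hb, b.2⟩)
  have key (a : A) (b : B) : g (a + b) = h b := by
    simpa using LinearMap.congr_fun hg (a, b)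
  refine Submodule.mem_sup.mpr ⟨g, fun a ha ↦ ?_, h - g, fun b hb ↦ ?_, add_sub_cancel g h⟩
  · simpa using key ⟨a, ha⟩ 0
  · have hgb : g b = h b := by simpa using key 0 ⟨b, hb⟩
    simp [hgb]

theorem IsSelfCogenerator.endAnnihilator_injective (hcog : IsSelfCogenerator R M) :
    Function.Injective (Submodule.endAnnihilator (R := R) (M := M)) := by
  have le_of_le (A B : Submodule R M) (hAB : A.endAnnihilator ≤ B.endAnnihilator) :
      B ≤ A := by
    intro x hx
    obtain ⟨ι, φ, hφ⟩ := hcog A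
    rw [← Submodule.Quotient.mk_eq_zero A]
    refine hφ (funext fun i ↦ ?_)
    have hmem : LinearMap.proj i ∘ₗ φ ∘ₗ A.mkQ ∈ A.endAnnihilator := fun y hy ↦ by
      simp [(Submodule.Quotient.mk_eq_zero A).mpr hy]
    simpa using hAB hmem x hx
  exact fun A B hAB ↦ le_antisymm (le_of_le B A hAB.ge) (le_of_le A B hAB.le)

end

theorem sup_inf_left_of_forall_inf_sup_left {α : Type*} [Lattice α]
    (h : ∀ a b c : α, a ⊓ (b ⊔ c) = (a ⊓ b) ⊔ (a ⊓ c)) (a b c : α) :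
    a ⊔ (b ⊓ c) = (a ⊔ b) ⊓ (a ⊔ c) :=
  letI := DistribLattice.ofInfSupLe fun a b c : α ↦ (h a b c).le
  sup_inf_left a b c

/-- A self-injective self-cogenerator left `R`-module `M` is distributive if and only if its
endomorphism ring is right distributive. -/
theorem distributive_iff_end_right_distributive {R : Type u} {M : Type v} [Ring R]
    [AddCommGroup M] [Module R M] (hinj : IsSelfInjective R M)
    (hcog : IsSelfCogenerator R M) :
    (∀ N L K : Submodule R M, N ⊓ (L ⊔ K) = (N ⊓ L) ⊔ (N ⊓ K)) ↔
      (∀ I J K : Ideal (Module.End R M), I ⊓ (J ⊔ K) = (I ⊓ J) ⊔ (I ⊓ K)) := by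
  constructor
  · intro hM I J K
    refine le_antisymm (fun x hx ↦ ?_) le_inf_sup
    obtain ⟨hxI, hxJK⟩ := hx
    obtain ⟨y, hy, z, hz, hyz⟩ := Submodule.mem_sup.mp hxJK
    have key : Ideal.span {x} ⊓ (Ideal.span {y} ⊔ Ideal.span {z}) =
        (Ideal.span {x} ⊓ Ideal.span {y}) ⊔ (Ideal.span {x} ⊓ Ideal.span {z}) := by
      simp only [← hinj.endAnnihilator_ker, ← hinj.endAnnihilator_inf,
        ← Submodule.endAnnihilator_sup, sup_inf_left_of_forall_inf_sup_left hM]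
    have hle {w : Module.End R M} {L : Ideal (Module.End R M)} (hw : w ∈ L) :
        Ideal.span {w} ≤ L := (Ideal.span_singleton_le_iff_mem L).mpr hw
    refine sup_le_sup (inf_le_inf (hle hxI) (hle hy)) (inf_le_inf (hle hxI) (hle hz))
      (key.le ⟨Ideal.mem_span_singleton_self x, ?_⟩)
    rw [← hyz]
    exact Submodule.add_mem_sup (Ideal.mem_span_singleton_self y)
      (Ideal.mem_span_singleton_self z)
  · intro hS N L K
    apply hcog.endAnnihilator_injective
    simp only [hinj.endAnnihilator_inf, Submodule.endAnnihilator_sup,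
      sup_inf_left_of_forall_inf_sup_left hS]
end

section
/- Let R be a ring and M a self-injective left R-module that is uniserial, i.e. its submodules are totally ordered by inclusion. Then End_R(M) is a right chain ring, i.e. its right ideals are totally ordered by inclusion. -/
/-!
STATEMENT 5. Endomorphisms of a left module are written on the right in the paper, so the
paper's endomorphism ring `S` is the opposite of Lean's `Module.End R M`; hence "`End_R(M)`
is a right chain ring" means that the `Ideal (Module.End R M)` (ideals for composition on
the left) are totally ordered by inclusion.
-/

universe u v

/-- Over a self-injective module, an endomorphism `g` whose kernel contains that of `f` factors
through `f`. -/
theorem IsSelfInjective.exists_mul_eq_of_ker_le_s5 {R : Type u} {M : Type v} [Ring R]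
    [AddCommGroup M] [Module R M] (hinj : IsSelfInjective R M) {f g : Module.End R M}
    (h : LinearMap.ker f ≤ LinearMap.ker g) : ∃ k : Module.End R M, k * f = g := by
  obtain ⟨k, hk⟩ := hinj (LinearMap.range f)
    ((LinearMap.ker f).liftQ g h ∘ₗ f.quotKerEquivRange.symm.toLinearMap)
  refine ⟨k, LinearMap.ext fun x => ?_⟩
  have hx := hk ⟨f x, LinearMap.mem_range_self f x⟩
  simpa [LinearMap.quotKerEquivRange_symm_apply_image] using hx

/-- The endomorphism ring of a self-injective uniserial module is a right chain ring. -/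
theorem end_chain_of_selfInjective_uniserial {R : Type u} {M : Type v} [Ring R]
    [AddCommGroup M] [Module R M] (hinj : IsSelfInjective R M)
    (huni : ∀ N L : Submodule R M, N ≤ L ∨ L ≤ N) :
    ∀ I J : Ideal (Module.End R M), I ≤ J ∨ J ≤ I := by
  intro I J
  by_contra! hIJ
  obtain ⟨f, hfI, hfJ⟩ := SetLike.not_le_iff_exists.mp hIJ.1
  obtain ⟨g, hgJ, hgI⟩ := SetLike.not_le_iff_exists.mp hIJ.2
  rcases huni (LinearMap.ker f) (LinearMap.ker g) with h | h
  · obtain ⟨k, rfl⟩ := hinj.exists_mul_eq_of_ker_le_s5 h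
    exact hgI (I.mul_mem_left k hfI)
  · obtain ⟨k, rfl⟩ := hinj.exists_mul_eq_of_ker_le_s5 h
    exact hfJ (J.mul_mem_left k hgJ)
end

section
/- Let {R_i}_{i ∈ I} be a family of right chain rings. Then the direct product ring R = ∏_{i ∈ I} R_i is a right distributive ring, i.e. its lattice of right ideals is distributive. -/
/-- In a right chain ring, a sum `j + k` splits as `(j + k) * e + (j + k) * (1 - e)` with the first
term a right multiple of `j` and the second one a right multiple of `k`. -/
theorem exists_add_mul_eq_mul_of_right_chain {S : Type*} [Ring S]
    (hchain : ∀ I J : Submodule Sᵐᵒᵖ S, I ≤ J ∨ J ≤ I) (j k : S) :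
    ∃ e c d : S, (j + k) * e = j * c ∧ (j + k) * (1 - e) = k * d := by
  rcases hchain (Submodule.span Sᵐᵒᵖ {j}) (Submodule.span Sᵐᵒᵖ {k}) with h | h
  · obtain ⟨a, rfl⟩ := Submodule.mem_span_singleton.1 (h (Submodule.mem_span_singleton_self j))
    exact ⟨0, 0, 1 + a.unop, by simp, by simp [MulOpposite.smul_eq_mul_unop, mul_add, add_comm]⟩
  · obtain ⟨a, rfl⟩ := Submodule.mem_span_singleton.1 (h (Submodule.mem_span_singleton_self k))
    exact ⟨1, 1 + a.unop, 0, by simp [MulOpposite.smul_eq_mul_unop, mul_add], by simp⟩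

/-- A right ideal is closed under right multiplication. -/
theorem Submodule.mul_mem_of_mulOpposite {S : Type*} [Ring S] (I : Submodule Sᵐᵒᵖ S) {x : S}
    (hx : x ∈ I) (a : S) : x * a ∈ I :=
  I.smul_mem (MulOpposite.op a) hx

universe u v

/-- A direct product of right chain rings is a right distributive ring: its lattice of
right ideals is distributive. -/
theorem pi_right_distributive_of_right_chain {ι : Type u} (R : ι → Type v)
    [∀ i, Ring (R i)]
    (hchain : ∀ i, ∀ I J : Submodule (R i)ᵐᵒᵖ (R i), I ≤ J ∨ J ≤ I) :
    ∀ I J K : Submodule (∀ i, R i)ᵐᵒᵖ (∀ i, R i), I ⊓ (J ⊔ K) = (I ⊓ J) ⊔ (I ⊓ K) := by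
  intro I J K
  refine le_antisymm ?_ le_inf_sup
  rintro x ⟨hxI, hx⟩
  obtain ⟨j, hj, k, hk, rfl⟩ := Submodule.mem_sup.1 hx
  choose e c d hc hd using fun i => exists_add_mul_eq_mul_of_right_chain (hchain i) (j i) (k i)
  have hjc : (j + k) * e = j * c := funext hc
  have hkd : (j + k) * (1 - e) = k * d := funext hd
  refine Submodule.mem_sup.2 ⟨(j + k) * e, ⟨I.mul_mem_of_mulOpposite hxI e, ?_⟩,
    (j + k) * (1 - e), ⟨I.mul_mem_of_mulOpposite hxI (1 - e), ?_⟩, ?_⟩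
  · rw [hjc]
    exact J.mul_mem_of_mulOpposite hj c
  · rw [hkd]
    exact K.mul_mem_of_mulOpposite hk d
  · rw [← mul_add, add_sub_cancel, mul_one]
end

section
/- Let k be a field, D a finite-dimensional division k-algebra, and M a D-D-bimodule whose two induced k-vector space structures agree and such that dim_k M = dim_k D. Then there exist a k-algebra automorphism α of D and a k-linear bijection f : M → D such that f(a · x) = a f(x) and f(x · a) = f(x) α(a) for all a ∈ D and x ∈ M; i.e. every such D-bimodule structure is equivalent to D_α for some α ∈ Aut_k(D). -/
universe u v w

/-- Let `D` be a finite-dimensional division algebra over a field `k`, and let `M` be a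
`D`-`D`-bimodule whose two induced `k`-vector space structures agree (both equal to a given
`k`-structure) and with `dim_k M = dim_k D`.  Then the bimodule `M` is equivalent to `D_α`
for some `α ∈ Aut_k(D)`: there are a `k`-algebra automorphism `α` of `D` and a `k`-linear
bijection `f : M → D` with `f (a • x) = a * f x` and `f (x • a) = f x * α a`. -/
theorem bimodule_on_division_algebra_is_twist
    (k : Type u) [Field k] (D : Type v) [DivisionRing D] [Algebra k D]
    [FiniteDimensional k D]
    (M : Type w) [AddCommGroup M] [Module D M] [Module Dᵐᵒᵖ M]
    [SMulCommClass D Dᵐᵒᵖ M]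
    [Module k M] [IsScalarTower k D M] [IsScalarTower k Dᵐᵒᵖ M]
    (hdim : Module.finrank k M = Module.finrank k D) :
    ∃ (α : D ≃ₐ[k] D) (f : M ≃ₗ[k] D),
      (∀ (a : D) (x : M), f (a • x) = a * f x) ∧
      (∀ (a : D) (x : M), f ((MulOpposite.op a) • x) = f x * α a) := by
  have hone : Module.finrank D M = Module.finrank D D := by
    have h := Module.finrank_mul_finrank k D M
    have hpos : 0 < Module.finrank k D := Module.finrank_pos
    rw [hdim] at h
    rw [Module.finrank_self]
    exact Nat.eq_of_mul_eq_mul_left hpos (by rw [h, mul_one])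
  have : Module.Finite D M :=
    Module.finite_of_finrank_pos (by rw [hone, Module.finrank_self]; exact one_pos)
  let e : M ≃ₗ[D] D := LinearEquiv.ofFinrankEq M D hone
  have key (a : D) (x : M) :
      e (MulOpposite.op a • x) = e x * e (MulOpposite.op a • e.symm 1) := by
    have hx : x = e x • e.symm 1 := by
      rw [← map_smul, smul_eq_mul, mul_one, e.symm_apply_apply]
    conv_lhs => rw [hx, ← smul_comm, map_smul, smul_eq_mul]
  let φ : D →ₐ[k] D := AlgHom.ofLinearMap
    { toFun := fun a => e (MulOpposite.op a • e.symm 1)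
      map_add' := fun a b => by rw [MulOpposite.op_add, add_smul, map_add]
      map_smul' := fun c a => by
        rw [MulOpposite.op_smul, smul_assoc, ← algebraMap_smul D c, map_smul,
          RingHom.id_apply, algebraMap_smul] }
    (by simp)
    (fun a b => by
      simp only [LinearMap.coe_mk, AddHom.coe_mk]
      rw [MulOpposite.op_mul, mul_smul, key b])
  have hφ : Function.Bijective φ := by
    have hinj : Function.Injective φ := φ.toRingHom.injective
    exact ⟨hinj, LinearMap.surjective_of_injective (f := φ.toLinearMap) hinj⟩
  exact ⟨AlgEquiv.ofBijective φ hφ, e.restrictScalars k, fun a x => e.map_smul a x, key⟩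
end
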